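/- arXiv:1711.04631 — 2 statements merged into one kernel-verified Lean document; each statement's English description precedes it below -/
import Mathlib

section
/- Let K ⊂ H⁺(y₀)×X be an isolated invariant set admitting a strongly admissible isolating neighborhood, let (A,R) be an attractor–repeller decomposition of K, and let (N₁,N₂,N₃) be an index triple for (y₀,K,A,R). Then for every T ≥ 0, both (N₁, N₂^{−T}(N₁), N₃) and (N₁, N₂^{−T}(N₁), N₃^{−T}(N₁)) are index triples for (y₀,K,A,R). -/
open Filter Topology Set
open scoped NNReal ENNReal

noncomputable section

/-- A partial semiflow on a topological space `Z`. The value `none` plays the role of the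
symbol `◊` ("undefined").  Time is modelled by `ℝ≥0`. -/
structure PartialSemiflow (Z : Type*) [TopologicalSpace Z] where
  /-- The (partially defined) flow map. -/
  flow : ℝ≥0 → Z → Option Z
  /-- The domain of definition is open in `[0,∞) × Z`. -/
  isOpen_dom : IsOpen {p : ℝ≥0 × Z | (flow p.1 p.2).isSome = true}
  /-- The flow is continuous on its domain of definition. -/
  continuous_flow : ∀ V : Set Z, IsOpen V →
    IsOpen {p : ℝ≥0 × Z | ∃ z ∈ V, flow p.1 p.2 = some z}
  /-- `z π 0 = z`. -/
  flow_zero : ∀ z, flow 0 z = some z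
  /-- The semigroup property; `◊ π t = ◊` is built into `Option.bind`. -/
  flow_add : ∀ (t₁ t₂ : ℝ≥0) (z : Z), flow (t₁ + t₂) z = (flow t₁ z).bind (flow t₂)

namespace PartialSemiflow

variable {Z : Type*} [TopologicalSpace Z] (π : PartialSemiflow Z)

/-- `π.mem t z M` means: `z π t` is defined and belongs to `M`. -/
def mem (t : ℝ≥0) (z : Z) (M : Set Z) : Prop := ∃ w ∈ M, π.flow t z = some w

/-- `π.segMem t z M` means `z π [0,t] ⊆ M`. -/
def segMem (t : ℝ≥0) (z : Z) (M : Set Z) : Prop := ∀ s ≤ t, π.mem s z M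

/-- A full solution `u : ℝ → Z` of the semiflow. -/
def IsSolution (u : ℝ → Z) : Prop :=
  ∀ (t₀ : ℝ) (s : ℝ≥0), π.flow s (u t₀) = some (u (t₀ + (s : ℝ)))

/-- The largest invariant subset of `N`. -/
def Inv (N : Set Z) : Set Z :=
  {z | ∃ u : ℝ → Z, π.IsSolution u ∧ (∀ t, u t ∈ N) ∧ u 0 = z}

/-- The largest negatively invariant subset of `N` (solutions on `(-∞,0]`). -/
def InvMinus (N : Set Z) : Set Z :=
  {z | ∃ u : ℝ → Z, (∀ t ≤ (0 : ℝ), u t ∈ N) ∧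
    (∀ (t₀ : ℝ) (s : ℝ≥0), t₀ + (s : ℝ) ≤ 0 → π.flow s (u t₀) = some (u (t₀ + (s : ℝ)))) ∧
    u 0 = z}

/-- Strong admissibility of a set `M`: asymptotic compactness together with
non-explosion of the semiflow in `M`. -/
def StronglyAdmissible (M : Set Z) : Prop :=
  (∀ (z : ℕ → Z) (t : ℕ → ℝ≥0),
      (∀ n, π.segMem (t n) (z n) M) →
      ∃ w : ℕ → Z, (∀ n, π.flow (t n) (z n) = some (w n)) ∧
        ∃ φ : ℕ → ℕ, StrictMono φ ∧ ∃ l : Z, Tendsto (w ∘ φ) atTop (nhds l)) ∧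
  (∀ (z : Z) (t : ℝ≥0), (∀ s < t, ∃ w ∈ M, π.flow s z = some w) → (π.flow t z).isSome)

end PartialSemiflow

/-- A global (everywhere defined) semiflow on `Y`, the "translation" `y ↦ y^t`. -/
structure GlobalSemiflow (Y : Type*) [TopologicalSpace Y] where
  /-- The translation map. -/
  trans : ℝ≥0 → Y → Y
  continuous_trans : Continuous fun p : ℝ≥0 × Y => trans p.1 p.2
  trans_zero : ∀ y, trans 0 y = y
  trans_add : ∀ (s t : ℝ≥0) (y : Y), trans (s + t) y = trans t (trans s y)

variable {X Y : Type*} [MetricSpace X] [MetricSpace Y]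

/-- `π` is a skew-product semiflow over the translation semiflow `σ`:  whenever
`(y,x) π t` is defined, its first component is `y^t`. -/
def GlobalSemiflow.IsSkewProduct (σ : GlobalSemiflow Y) (π : PartialSemiflow (Y × X)) : Prop :=
  ∀ (t : ℝ≥0) (y : Y) (x : X) (w : Y × X), π.flow t (y, x) = some w → w.1 = σ.trans t y

/-- The positive hull `H⁺(y₀)` of `y₀`. -/
def hullPlus (σ : GlobalSemiflow Y) (y₀ : Y) : Set Y :=
  closure {y | ∃ t : ℝ≥0, σ.trans t y₀ = y}

/-- The space `H⁺(y₀) × X`, as a subset of `Y × X`. -/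
def extSpace (σ : GlobalSemiflow Y) (y₀ : Y) : Set (Y × X) :=
  (hullPlus σ y₀) ×ˢ (Set.univ : Set X)

/-- The map `r = r_{y₀} : [0,∞) × X → H⁺(y₀) × X`, `r(t,x) = (y₀^t, x)`. -/
def rMap (σ : GlobalSemiflow Y) (y₀ : Y) : ℝ≥0 × X → Y × X :=
  fun p => (σ.trans p.1 y₀, p.2)

/-- The canonical semiflow `χ = χ_{y₀}` on `[0,∞) × X`:
`(t,x) χ s = (t+s, Φ(s, y₀^t, x))`. -/
def chi (σ : GlobalSemiflow Y) (π : PartialSemiflow (Y × X)) (y₀ : Y)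
    (s : ℝ≥0) (p : ℝ≥0 × X) : Option (ℝ≥0 × X) :=
  (π.flow s (σ.trans p.1 y₀, p.2)).map fun w => (p.1 + s, w.2)

/-- `chiMem σ π y₀ s p M` means: `p χ s` is defined and belongs to `M`. -/
def chiMem (σ : GlobalSemiflow Y) (π : PartialSemiflow (Y × X)) (y₀ : Y)
    (s : ℝ≥0) (p : ℝ≥0 × X) (M : Set (ℝ≥0 × X)) : Prop :=
  ∃ q ∈ M, chi σ π y₀ s p = some q

/-- `N` is an isolating neighborhood for `K` in `H⁺(y₀) × X`. -/
def IsIsolatingNbhd (σ : GlobalSemiflow Y) (π : PartialSemiflow (Y × X)) (y₀ : Y)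
    (K N : Set (Y × X)) : Prop :=
  N ⊆ extSpace σ y₀ ∧ IsClosed N ∧
  (∀ z ∈ π.Inv N, N ∈ nhdsWithin z (extSpace σ y₀)) ∧ K = π.Inv N

/-- `W` is a neighborhood of `K` in `H⁺(y₀) × X`. -/
def IsNbhdOfIn (σ : GlobalSemiflow Y) (y₀ : Y) (K W : Set (Y × X)) : Prop :=
  W ⊆ extSpace σ y₀ ∧ ∀ z ∈ K, W ∈ nhdsWithin z (extSpace (X := X) σ y₀)

/-- A basic index pair in `[0,∞) × X` relative to the semiflow `χ_{y₀}`. -/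
structure IsBasicIndexPair (σ : GlobalSemiflow Y) (π : PartialSemiflow (Y × X)) (y₀ : Y)
    (N₁ N₂ : Set (ℝ≥0 × X)) : Prop where
  subset : N₂ ⊆ N₁
  closed₁ : IsClosed N₁
  closed₂ : IsClosed N₂
  ip2 : ∀ p ∈ N₁, ∀ t : ℝ≥0, ¬ chiMem σ π y₀ t p N₁ → ∃ s ≤ t, chiMem σ π y₀ s p N₂
  ip3 : ∀ p ∈ N₂, ∀ t : ℝ≥0, ¬ chiMem σ π y₀ t p N₂ → ∃ s ≤ t, ¬ chiMem σ π y₀ s p N₁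

/-- An index pair for `(y₀, K)`. -/
structure IsIndexPair (σ : GlobalSemiflow Y) (π : PartialSemiflow (Y × X)) (y₀ : Y)
    (K : Set (Y × X)) (N₁ N₂ : Set (ℝ≥0 × X)) : Prop where
  toBasic : IsBasicIndexPair σ π y₀ N₁ N₂
  ip4 : ∃ N : Set (Y × X), IsIsolatingNbhd σ π y₀ K N ∧ π.StronglyAdmissible N ∧
    N₁ \ N₂ ⊆ rMap σ y₀ ⁻¹' N
  ip5 : ∃ W : Set (Y × X), IsNbhdOfIn σ y₀ K W ∧ rMap σ y₀ ⁻¹' W ⊆ N₁ \ N₂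

/-- `N₂^{-T}(N₁) = {p ∈ N₁ : p χ s ∈ N₂ for some s ∈ [0,T]}`. -/
def backSet (σ : GlobalSemiflow Y) (π : PartialSemiflow (Y × X)) (y₀ : Y)
    (N₁ N₂ : Set (ℝ≥0 × X)) (T : ℝ≥0) : Set (ℝ≥0 × X) :=
  {p ∈ N₁ | ∃ s ≤ T, chiMem σ π y₀ s p N₂}


/-- The relation identifying all points of `A ∩ B`, together with an extra point
(which serves as the class `[B]` even when `A ∩ B = ∅`). -/
def quotRel {Z : Type*} (A B : Set Z) : ↥A ⊕ Unit → ↥A ⊕ Unit → Prop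
  | Sum.inl a, Sum.inl b => a = b ∨ ((a : Z) ∈ B ∧ (b : Z) ∈ B)
  | Sum.inl a, Sum.inr _ => (a : Z) ∈ B
  | Sum.inr _, Sum.inl b => (b : Z) ∈ B
  | Sum.inr _, Sum.inr _ => True

/-- The pointed quotient space `A/B`. -/
def PtdQuot {Z : Type*} [TopologicalSpace Z] (A B : Set Z) : Type _ := Quot (quotRel A B)

instance {Z : Type*} [TopologicalSpace Z] (A B : Set Z) : TopologicalSpace (PtdQuot A B) :=
  inferInstanceAs (TopologicalSpace (Quot _))

/-- The base point `[B]` of `A/B`. -/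
def PtdQuot.pt {Z : Type*} [TopologicalSpace Z] (A B : Set Z) : PtdQuot A B :=
  Quot.mk _ (Sum.inr ())

/-- `f : (Z, z₀) → (W, w₀)` is a pointed homotopy equivalence. -/
def IsPointedHomotopyEquiv {Z W : Type*} [TopologicalSpace Z] [TopologicalSpace W]
    (z₀ : Z) (w₀ : W) (f : C(Z, W)) : Prop :=
  f z₀ = w₀ ∧ ∃ g : C(W, Z), g w₀ = z₀ ∧
    Nonempty (ContinuousMap.HomotopyRel (g.comp f) (ContinuousMap.id Z) {z₀}) ∧
    Nonempty (ContinuousMap.HomotopyRel (f.comp g) (ContinuousMap.id W) {w₀})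

/-- There is a pointed homotopy equivalence `(Z,z₀) → (W,w₀)`. -/
def PointedHomotopyEquivalent {Z W : Type*} [TopologicalSpace Z] [TopologicalSpace W]
    (z₀ : Z) (w₀ : W) : Prop :=
  ∃ f : C(Z, W), IsPointedHomotopyEquiv z₀ w₀ f

variable {X Y : Type*} [MetricSpace X] [MetricSpace Y]

/-- `g⁺(z) = sup{t ≥ 0 : z π [0,t] ⊆ U}`, with `sup ∅ = 0`, valued in `[0,∞]`. -/
def gPlus (π : PartialSemiflow (Y × X)) (U : Set (Y × X)) (z : Y × X) : ℝ≥0∞ :=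
  ⨆ t ∈ {t : ℝ≥0 | π.segMem t z U}, (t : ℝ≥0∞)

/-- `g⁻(z) = sup{d(z π t, Inv⁻(N)) : t ∈ [0, g⁺(z)], z π t ≠ ◊}`, with `sup ∅ = 0`
and `d(·,∅) = ∞`, valued in `[0,∞]`. -/
def gMinus (π : PartialSemiflow (Y × X)) (U N : Set (Y × X)) (z : Y × X) : ℝ≥0∞ :=
  ⨆ t ∈ {t : ℝ≥0 | (t : ℝ≥0∞) ≤ gPlus π U z},
    ⨆ w ∈ {w : Y × X | π.flow t z = some w}, EMetric.infEdist w (π.InvMinus N)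

/-- The function `f(p) = sup{t₀ ≥ 0 : p χ s ∈ cl(N₁ \ N₂) for all s ∈ [0,t₀]}`,
with `sup ∅ = 0`, valued in `[0,∞]`. -/
def fTime (σ : GlobalSemiflow Y) (π : PartialSemiflow (Y × X)) (y₀ : Y)
    (N₁ N₂ : Set (ℝ≥0 × X)) (p : ℝ≥0 × X) : ℝ≥0∞ :=
  ⨆ t₀ ∈ {t₀ : ℝ≥0 | ∀ s ≤ t₀, chiMem σ π y₀ s p (closure (N₁ \ N₂))}, (t₀ : ℝ≥0∞)

/-- The α-limit set of a full solution `u`. -/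
def solAlphaLimit (u : ℝ → Y × X) : Set (Y × X) := ⋂ t : ℝ, closure (u '' Set.Iic t)

/-- The ω-limit set of a full solution `u`. -/
def solOmegaLimit (u : ℝ → Y × X) : Set (Y × X) := ⋂ t : ℝ, closure (u '' Set.Ici t)

/-- `(A, R)` is an attractor-repeller decomposition of the isolated invariant set `K`. -/
structure IsARDecomp (σ : GlobalSemiflow Y) (π : PartialSemiflow (Y × X)) (y₀ : Y)
    (K A R : Set (Y × X)) : Prop where
  A_subset : A ⊆ K
  R_subset : R ⊆ K
  disjoint : Disjoint A R
  A_isolated : ∃ N, IsIsolatingNbhd σ π y₀ A N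
  R_isolated : ∃ N, IsIsolatingNbhd σ π y₀ R N
  alternatives : ∀ u : ℝ → Y × X, π.IsSolution u → (∀ t, u t ∈ K) →
    (∀ t, u t ∈ A) ∨ (∀ t, u t ∈ R) ∨ (solAlphaLimit u ⊆ R ∧ solOmegaLimit u ⊆ A)

/-- An index triple for `(y₀, K, A, R)`. -/
structure IsIndexTriple (σ : GlobalSemiflow Y) (π : PartialSemiflow (Y × X)) (y₀ : Y)
    (K A R : Set (Y × X)) (N₁ N₂ N₃ : Set (ℝ≥0 × X)) : Prop where
  sub32 : N₃ ⊆ N₂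
  sub21 : N₂ ⊆ N₁
  pairK : IsIndexPair σ π y₀ K N₁ N₃
  pairA : IsIndexPair σ π y₀ A N₂ N₃

/-- An FM-index pair for `K` relative to `π`, restricted to `H⁺(y₀) × X`. -/
structure IsFMIndexPair (σ : GlobalSemiflow Y) (π : PartialSemiflow (Y × X)) (y₀ : Y)
    (K N₁ N₂ : Set (Y × X)) : Prop where
  subset : N₂ ⊆ N₁
  sub_ext : N₁ ⊆ extSpace σ y₀
  closed₁ : IsClosed N₁
  closed₂ : IsClosed N₂
  isolating : IsIsolatingNbhd σ π y₀ K (closure (N₁ \ N₂))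
  interior_K : ∀ z ∈ K, N₁ \ N₂ ∈ nhdsWithin z (extSpace σ y₀)
  posInv : ∀ z ∈ N₂, ∀ t : ℝ≥0, (∀ s ≤ t, π.mem s z N₁) → ∀ s ≤ t, π.mem s z N₂
  exit : ∀ z ∈ N₁, ∀ t : ℝ≥0, ¬ π.mem t z N₁ →
    ∃ s ≤ t, (∀ s' ≤ s, π.mem s' z N₁) ∧ π.mem s z N₂


theorem PartialSemiflow.tendsto_flow {Z : Type*} [TopologicalSpace Z] (π : PartialSemiflow Z)
    {ι : Type*} {F : Filter ι} {s : ι → ℝ≥0} {z w : ι → Z} {s₀ : ℝ≥0} {z₀ w₀ : Z}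
    (hs : Tendsto s F (𝓝 s₀)) (hz : Tendsto z F (𝓝 z₀)) (h₀ : π.flow s₀ z₀ = some w₀)
    (hw : ∀ᶠ i in F, π.flow (s i) (z i) = some (w i)) : Tendsto w F (𝓝 w₀) := by
  rw [tendsto_nhds]
  intro V hV hwV
  have h := (hs.prodMk_nhds hz).eventually
    ((π.continuous_flow V hV).mem_nhds ⟨w₀, hwV, h₀⟩)
  filter_upwards [h, hw] with i ⟨v, hv, hiv⟩ hi
  obtain rfl : v = w i := Option.some.inj (hiv.symm.trans hi)
  exact hv

theorem PartialSemiflow.StronglyAdmissible.mono {Z : Type*} [TopologicalSpace Z]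
    {π : PartialSemiflow Z} {M N : Set Z} (hN : π.StronglyAdmissible N) (h : M ⊆ N) :
    π.StronglyAdmissible M := by
  refine ⟨fun z t hz => hN.1 z t fun n s hs => ?_, fun z t hz => hN.2 z t fun s hs => ?_⟩
  · obtain ⟨w, hw, hf⟩ := hz n s hs
    exact ⟨w, h hw, hf⟩
  · obtain ⟨w, hw, hf⟩ := hz s hs
    exact ⟨w, h hw, hf⟩

theorem PartialSemiflow.IsSolution.mem_inv {Z : Type*} [TopologicalSpace Z]
    {π : PartialSemiflow Z} {u : ℝ → Z} (hu : π.IsSolution u) {N : Set Z}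
    (hN : ∀ t, u t ∈ N) (t : ℝ) : u t ∈ π.Inv N := by
  refine ⟨fun s => u (t + s), fun t₀ s => ?_, fun s => hN _, by simp⟩
  simpa [add_assoc] using hu (t + t₀) s

/-- In a metric space, a set all of whose sequences have convergent subsequences has compact
closure. -/
theorem isCompact_closure_of_subseq_tendsto {Z : Type*} [MetricSpace Z] {S : Set Z}
    (h : ∀ x : ℕ → Z, (∀ n, x n ∈ S) →
      ∃ φ : ℕ → ℕ, StrictMono φ ∧ ∃ l, Tendsto (x ∘ φ) atTop (𝓝 l)) :
    IsCompact (closure S) := by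
  refine IsSeqCompact.isCompact fun x hx => ?_
  have hpos : ∀ n : ℕ, (0 : ℝ) < 1 / (n + 1) := fun n => Nat.one_div_pos_of_nat
  choose y hyS hxy using fun n => Metric.mem_closure_iff.1 (hx n) _ (hpos n)
  obtain ⟨φ, hφ, l, hl⟩ := h y hyS
  have hd : Tendsto (fun n => dist (y n) (x n)) atTop (𝓝 0) :=
    squeeze_zero (fun _ => dist_nonneg) (fun n => by rw [dist_comm]; exact (hxy n).le)
      tendsto_one_div_add_atTop_nhds_zero_nat
  have hlx : Tendsto (x ∘ φ) atTop (𝓝 l) := hl.congr_dist (hd.comp hφ.tendsto_atTop)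
  exact ⟨l, isClosed_closure.mem_of_tendsto hlx (.of_forall fun n => hx _), φ, hφ, hlx⟩

/-- A closed strongly admissible set containing a forward half of a full solution contains a
full solution. -/
theorem PartialSemiflow.inv_nonempty_of_forward {Z : Type*} [MetricSpace Z]
    (π : PartialSemiflow Z) {P : Set Z} (hP : IsClosed P) (hadm : π.StronglyAdmissible P)
    {u : ℝ → Z} (hu : π.IsSolution u) (huP : ∀ t, 0 ≤ t → u t ∈ P) : (π.Inv P).Nonempty := by
  have hC : IsCompact (closure (u '' Ici 0)) := by
    refine isCompact_closure_of_subseq_tendsto fun x hx => ?_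
    choose t ht htx using hx
    obtain ⟨w, hw, φ, hφ, l, hl⟩ := hadm.1 (fun _ => u 0) (fun n => ⟨t n, ht n⟩)
      fun n s _ => ⟨u s, huP _ s.2, by simpa using hu 0 s⟩
    obtain rfl : w = x := by
      funext n
      have := hu 0 ⟨t n, ht n⟩
      rw [hw n] at this
      rw [Option.some.inj this, ← htx n, zero_add]
      rfl
    exact ⟨φ, hφ, l, hl⟩
  have hev : ∀ t : ℝ, ∀ᶠ n : ℕ in (hyperfilter ℕ : Filter ℕ), 0 ≤ (n : ℝ) + t := fun t => by
    have : ∀ᶠ n : ℕ in atTop, 0 ≤ (n : ℝ) + t :=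
      (tendsto_natCast_atTop_atTop.eventually_ge_atTop (-t)).mono fun n hn => by linarith
    exact this.filter_mono Nat.hyperfilter_le_atTop
  have hlim : ∀ t : ℝ, ∃ l, Tendsto (fun n : ℕ => u (n + t)) (hyperfilter ℕ) (𝓝 l) := fun t => by
    obtain ⟨l, -, hl⟩ := hC.ultrafilter_le_nhds ((hyperfilter ℕ).map fun n : ℕ => u (n + t))
      (le_principal_iff.2 ((hev t).mono fun n hn => subset_closure ⟨_, hn, rfl⟩))
    exact ⟨l, hl⟩
  choose v hv using hlim
  have hvP : ∀ t, v t ∈ P := fun t =>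
    hP.mem_of_tendsto (hv t) ((hev t).mono fun n hn => huP _ hn)
  have hflow : ∀ (t : ℝ) (s : ℝ≥0) (w : Z), π.flow s (v t) = some w → w = v (t + s) := by
    intro t s w hw
    refine tendsto_nhds_unique ?_ (hv (t + s))
    refine π.tendsto_flow tendsto_const_nhds (hv t) hw (.of_forall fun n => ?_)
    simpa [add_assoc] using hu (n + t) s
  have hdef : ∀ (t : ℝ) (s : ℝ≥0), (π.flow s (v t)).isSome := by
    intro t s
    by_contra hs
    let E : Set ℝ≥0 := {s | ¬ (π.flow s (v t)).isSome = true}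
    have hE : IsClosed E := (π.isOpen_dom.preimage
      (f := fun s : ℝ≥0 => (s, v t)) (by fun_prop)).isClosed_compl
    refine hE.csInf_mem ⟨s, hs⟩ (OrderBot.bddBelow _) (hadm.2 _ _ fun s' hs' => ?_)
    have hs'E : s' ∉ E := notMem_of_lt_csInf hs' (OrderBot.bddBelow _)
    obtain ⟨w, hw⟩ := Option.isSome_iff_exists.1 (not_not.1 hs'E)
    exact ⟨w, hflow t s' w hw ▸ hvP _, hw⟩
  refine ⟨v 0, v, fun t s => ?_, hvP, rfl⟩
  obtain ⟨w, hw⟩ := Option.isSome_iff_exists.1 (hdef t s)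
  rw [hw, hflow t s w hw]

/-- A bounded family of times converges along any ultrafilter. -/
theorem exists_tendsto_of_le_nnreal {ι : Type*} (F : Ultrafilter ι) {s : ι → ℝ≥0} {T : ℝ≥0}
    (hs : ∀ᶠ i in (F : Filter ι), s i ≤ T) :
    ∃ s₀ ≤ T, Tendsto s F (𝓝 s₀) := by
  obtain ⟨s₀, h₀, h⟩ := (isCompact_Icc (a := (0 : ℝ≥0)) (b := T)).ultrafilter_le_nhds (F.map s)
    (le_principal_iff.2 (hs.mono fun i hi => ⟨zero_le, hi⟩))
  exact ⟨s₀, h₀.2, h⟩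

section Chi

variable {σ : GlobalSemiflow Y} {π : PartialSemiflow (Y × X)} {y₀ : Y}

theorem chi_eq_some_iff {s : ℝ≥0} {p q : ℝ≥0 × X} :
    chi σ π y₀ s p = some q ↔
      ∃ w, π.flow s (rMap σ y₀ p) = some w ∧ (p.1 + s, w.2) = q := by
  simp only [chi, Option.map_eq_some_iff, rMap]

theorem flow_rMap_of_chi (hσπ : σ.IsSkewProduct π) {s : ℝ≥0} {p q : ℝ≥0 × X}
    (h : chi σ π y₀ s p = some q) : π.flow s (rMap σ y₀ p) = some (rMap σ y₀ q) := by
  obtain ⟨w, hw, rfl⟩ := chi_eq_some_iff.1 h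
  rw [hw, rMap, σ.trans_add, ← hσπ _ _ _ _ hw]

theorem chi_add (hσπ : σ.IsSkewProduct π) {s : ℝ≥0} {p q : ℝ≥0 × X}
    (h : chi σ π y₀ s p = some q) (t : ℝ≥0) : chi σ π y₀ t q = chi σ π y₀ (s + t) p := by
  have hq := flow_rMap_of_chi hσπ h
  obtain ⟨w, hw, rfl⟩ := chi_eq_some_iff.1 h
  have := π.flow_add s t (rMap σ y₀ p)
  rw [hq, Option.bind_some] at this
  simp only [rMap] at this
  simp only [chi, this, add_assoc]

theorem chiMem_add (hσπ : σ.IsSkewProduct π) {s : ℝ≥0} {p q : ℝ≥0 × X}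
    (h : chi σ π y₀ s p = some q) (t : ℝ≥0) (M : Set (ℝ≥0 × X)) :
    chiMem σ π y₀ t q M ↔ chiMem σ π y₀ (s + t) p M := by
  simp only [chiMem, chi_add hσπ h]

theorem chi_zero (p : ℝ≥0 × X) : chi σ π y₀ 0 p = some p := by
  simp [chi, π.flow_zero]

theorem chiMem_zero {p : ℝ≥0 × X} {M : Set (ℝ≥0 × X)} (hp : p ∈ M) : chiMem σ π y₀ 0 p M :=
  ⟨p, hp, chi_zero p⟩

theorem chiMem.mono {s : ℝ≥0} {p : ℝ≥0 × X} {M N : Set (ℝ≥0 × X)}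
    (h : chiMem σ π y₀ s p M) (hMN : M ⊆ N) : chiMem σ π y₀ s p N := by
  obtain ⟨q, hq, h⟩ := h
  exact ⟨q, hMN hq, h⟩

theorem continuous_rMap : Continuous (rMap σ y₀ : ℝ≥0 × X → Y × X) :=
  (σ.continuous_trans.comp (continuous_fst.prodMk continuous_const)).prodMk continuous_snd

theorem rMap_mem_extSpace (p : ℝ≥0 × X) : rMap σ y₀ p ∈ extSpace (X := X) σ y₀ :=
  ⟨subset_closure ⟨p.1, rfl⟩, mem_univ _⟩

theorem extSpace_subset_closure_range :
    extSpace (X := X) σ y₀ ⊆ closure (range (rMap σ y₀)) := by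
  have h : range (rMap σ y₀ : ℝ≥0 × X → Y × X) = {y | ∃ t : ℝ≥0, σ.trans t y₀ = y} ×ˢ univ := by
    ext ⟨y, x⟩
    simp [rMap]
  rw [h, closure_prod_eq, closure_univ]
  rfl

/-- The closure of the image of a set containing `r⁻¹(W)` is a neighborhood of every point of
which `W` is a neighborhood. -/
theorem closure_image_rMap_mem_nhdsWithin {W : Set (Y × X)} {M : Set (ℝ≥0 × X)} {z : Y × X}
    (hW : W ∈ 𝓝[extSpace σ y₀] z) (hWM : rMap σ y₀ ⁻¹' W ⊆ M) :
    closure (rMap σ y₀ '' M) ∈ 𝓝[extSpace σ y₀] z := by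
  obtain ⟨O, hO, hzO, hOW⟩ := mem_nhdsWithin.1 hW
  refine mem_nhdsWithin.2 ⟨O, hO, hzO, fun x ⟨hxO, hx⟩ => ?_⟩
  refine closure_mono ?_ (hO.inter_closure ⟨hxO, extSpace_subset_closure_range hx⟩)
  rintro _ ⟨hpO, p, rfl⟩
  exact ⟨p, hWM (hOW ⟨hpO, rMap_mem_extSpace p⟩), rfl⟩

theorem eventually_rMap_mem {ι : Type*} {F : Filter ι} {q : ι → ℝ≥0 × X} {z : Y × X}
    {W : Set (Y × X)} (hq : Tendsto (fun i => rMap σ y₀ (q i)) F (𝓝 z))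
    (hW : W ∈ 𝓝[extSpace σ y₀] z) : ∀ᶠ i in F, rMap σ y₀ (q i) ∈ W :=
  (tendsto_nhdsWithin_iff.2 ⟨hq, .of_forall fun i => rMap_mem_extSpace (q i)⟩).eventually hW

theorem subset_backSet {N₁ N₂ : Set (ℝ≥0 × X)} (h : N₂ ⊆ N₁) (T : ℝ≥0) :
    N₂ ⊆ backSet σ π y₀ N₁ N₂ T :=
  fun _ hp => ⟨h hp, 0, zero_le, chiMem_zero hp⟩

theorem backSet_mono {N₁ N₂ N₃ : Set (ℝ≥0 × X)} (h : N₃ ⊆ N₂) (T : ℝ≥0) :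
    backSet σ π y₀ N₁ N₃ T ⊆ backSet σ π y₀ N₁ N₂ T := by
  rintro p ⟨hp, s, hs, hsp⟩
  exact ⟨hp, s, hs, hsp.mono h⟩

theorem isClosed_backSet (hσπ : σ.IsSkewProduct π) {N₁ N₂ N₃ : Set (ℝ≥0 × X)}
    (h : IsBasicIndexPair σ π y₀ N₁ N₃) (h32 : N₃ ⊆ N₂) (h₂ : IsClosed N₂) (T : ℝ≥0) :
    IsClosed (backSet σ π y₀ N₁ N₂ T) := by
  refine IsSeqClosed.isClosed fun p p₀ hp hp₀ => ?_
  have hp₁ : p₀ ∈ N₁ := h.closed₁.mem_of_tendsto hp₀ (.of_forall fun n => (hp n).1)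
  choose s hsT q hq hpq using fun n => (hp n).2
  obtain ⟨s₀, hs₀, hs⟩ := exists_tendsto_of_le_nnreal (hyperfilter ℕ) (.of_forall hsT)
  replace hp₀ := hp₀.mono_left Nat.hyperfilter_le_atTop
  refine ⟨hp₁, ?_⟩
  rcases hc : chi σ π y₀ s₀ p₀ with _ | q₀
  · obtain ⟨t, ht, htN⟩ := h.ip2 p₀ hp₁ s₀ (by simp [chiMem, hc])
    exact ⟨t, ht.trans hs₀, htN.mono h32⟩
  · refine ⟨s₀, hs₀, q₀, h₂.mem_of_tendsto (f := q) (b := hyperfilter ℕ) ?_ (.of_forall hq), hc⟩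
    obtain ⟨w, hw, rfl⟩ := chi_eq_some_iff.1 hc
    have hr := π.tendsto_flow hs ((continuous_rMap.tendsto p₀).comp hp₀) hw
      (.of_forall fun n => flow_rMap_of_chi hσπ (hpq n))
    have hfst : ∀ n, (p n).1 + s n = (q n).1 := fun n => by
      obtain ⟨_, _, h⟩ := chi_eq_some_iff.1 (hpq n)
      exact congrArg Prod.fst h
    have hlim : Tendsto (fun n => ((q n).1, (q n).2)) (hyperfilter ℕ) (𝓝 (p₀.1 + s₀, w.2)) :=
      ((hp₀.fst_nhds.add hs).congr hfst).prodMk_nhds hr.snd_nhds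
    exact hlim

/-- A point whose forward orbit stays inside the neighborhood `W` with `r⁻¹(W) ∩ N₃ = ∅` is not
a limit of points `r(p)` with `p` hitting `N₃` within time `T`. -/
theorem notMem_closure_image_backSet (hσπ : σ.IsSkewProduct π) {N₁ N₃ : Set (ℝ≥0 × X)}
    {W : Set (Y × X)} (hWN : rMap σ y₀ ⁻¹' W ⊆ N₁ \ N₃) {z : Y × X}
    (hz : ∀ s, ∃ w, π.flow s z = some w ∧ W ∈ 𝓝[extSpace σ y₀] w) (T : ℝ≥0) :
    z ∉ closure (rMap σ y₀ '' backSet σ π y₀ N₁ N₃ T) := by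
  intro hcl
  obtain ⟨x, hx, hxz⟩ := mem_closure_iff_seq_limit.1 hcl
  choose p hp hpx using hx
  choose s hsT q hq hpq using fun n => (hp n).2
  obtain ⟨s₀, -, hs⟩ := exists_tendsto_of_le_nnreal (hyperfilter ℕ) (.of_forall hsT)
  obtain ⟨w, hw, hWw⟩ := hz s₀
  have hr := π.tendsto_flow hs (hxz.mono_left Nat.hyperfilter_le_atTop) hw
    (.of_forall fun n => hpx n ▸ flow_rMap_of_chi hσπ (hpq n))
  obtain ⟨n, hn⟩ := (eventually_rMap_mem hr hWw).exists
  exact (hWN hn).2 (hq n)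

/-- Leaving `N₂^{-T}(N₁)` forces a visit to `N₃`. -/
theorem exists_chiMem_of_not_chiMem_backSet (hσπ : σ.IsSkewProduct π)
    {N₁ N₂ N₃ : Set (ℝ≥0 × X)} (h13 : IsBasicIndexPair σ π y₀ N₁ N₃)
    (h23 : IsBasicIndexPair σ π y₀ N₂ N₃) (h21 : N₂ ⊆ N₁) {T : ℝ≥0}
    {p : ℝ≥0 × X} (hp : p ∈ backSet σ π y₀ N₁ N₂ T) {t : ℝ≥0}
    (ht : ¬ chiMem σ π y₀ t p (backSet σ π y₀ N₁ N₂ T)) :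
    ∃ s ≤ t, chiMem σ π y₀ s p N₃ := by
  obtain ⟨hp₁, s, hsT, hs⟩ := hp
  by_cases htN : chiMem σ π y₀ t p N₁
  · rcases le_total t s with hts | hst
    · obtain ⟨q, hq, hpq⟩ := htN
      refine absurd ⟨q, ⟨hq, s - t, tsub_le_self.trans hsT, ?_⟩, hpq⟩ ht
      rwa [chiMem_add hσπ hpq, add_tsub_cancel_of_le hts]
    · obtain ⟨q, hq, hpq⟩ := hs
      obtain ⟨s', hs', h'⟩ := h23.ip2 q hq (t - s) fun hc => ht <| by
        rw [chiMem_add hσπ hpq, add_tsub_cancel_of_le hst] at hc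
        exact hc.mono (subset_backSet h21 T)
      refine ⟨s + s', ?_, (chiMem_add hσπ hpq _ _).1 h'⟩
      calc s + s' ≤ s + (t - s) := by gcongr
        _ = t := add_tsub_cancel_of_le hst
  · exact h13.ip2 p hp₁ t htN

theorem IsBasicIndexPair.backSet_left (hσπ : σ.IsSkewProduct π)
    {N₁ N₂ N₃ : Set (ℝ≥0 × X)} (h13 : IsBasicIndexPair σ π y₀ N₁ N₃)
    (h23 : IsBasicIndexPair σ π y₀ N₂ N₃) (h21 : N₂ ⊆ N₁) (T : ℝ≥0) :
    IsBasicIndexPair σ π y₀ (backSet σ π y₀ N₁ N₂ T) N₃ where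
  subset := h23.subset.trans (subset_backSet h21 T)
  closed₁ := isClosed_backSet hσπ h13 h23.subset h23.closed₁ T
  closed₂ := h13.closed₂
  ip2 _ hp _ ht := exists_chiMem_of_not_chiMem_backSet hσπ h13 h23 h21 hp ht
  ip3 p hp t ht := by
    obtain ⟨s, hs, h⟩ := h13.ip3 p hp t ht
    exact ⟨s, hs, fun hc => h (hc.mono fun _ hq => hq.1)⟩

theorem IsBasicIndexPair.backSet_right (hσπ : σ.IsSkewProduct π)
    {N₁ N₃ : Set (ℝ≥0 × X)} (h : IsBasicIndexPair σ π y₀ N₁ N₃) (T : ℝ≥0) :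
    IsBasicIndexPair σ π y₀ N₁ (backSet σ π y₀ N₁ N₃ T) where
  subset _ hp := hp.1
  closed₁ := h.closed₁
  closed₂ := isClosed_backSet hσπ h subset_rfl h.closed₂ T
  ip2 p hp t ht := by
    obtain ⟨s, hs, h'⟩ := h.ip2 p hp t ht
    exact ⟨s, hs, h'.mono (subset_backSet h.subset T)⟩
  ip3 := by
    rintro p ⟨hp₁, s, hsT, hs⟩ t ht
    by_cases htN : chiMem σ π y₀ t p N₁
    · rcases le_total t s with hts | hst
      · obtain ⟨q, hq, hpq⟩ := htN
        refine absurd ⟨q, ⟨hq, s - t, tsub_le_self.trans hsT, ?_⟩, hpq⟩ ht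
        rwa [chiMem_add hσπ hpq, add_tsub_cancel_of_le hts]
      · obtain ⟨q, hq, hpq⟩ := hs
        obtain ⟨s', hs', h'⟩ := h.ip3 q hq (t - s) fun hc => ht <| by
          rw [chiMem_add hσπ hpq, add_tsub_cancel_of_le hst] at hc
          exact hc.mono (subset_backSet h.subset T)
        refine ⟨s + s', ?_, fun hc => h' ((chiMem_add hσπ hpq _ _).2 hc)⟩
        calc s + s' ≤ s + (t - s) := by gcongr
          _ = t := add_tsub_cancel_of_le hst
    · exact ⟨t, le_rfl, htN⟩

/-- Enlarging the exit set `N₃` to `N₃^{-T}(N₁)` keeps the index pair property. -/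
theorem IsIndexPair.backSet_exit (hσπ : σ.IsSkewProduct π) {K L : Set (Y × X)}
    {N₁ M N₃ : Set (ℝ≥0 × X)} (hK : IsIndexPair σ π y₀ K N₁ N₃)
    (hL : IsIndexPair σ π y₀ L M N₃) (hLK : L ⊆ K) (T : ℝ≥0)
    (hbasic : IsBasicIndexPair σ π y₀ M (backSet σ π y₀ N₁ N₃ T)) :
    IsIndexPair σ π y₀ L M (backSet σ π y₀ N₁ N₃ T) := by
  obtain ⟨N, ⟨-, -, -, rfl⟩, -, -⟩ := hK.ip4
  obtain ⟨W, hW, hWN⟩ := hK.ip5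
  obtain ⟨V, hV, hVM⟩ := hL.ip5
  obtain ⟨N', hN', hadm, hsub⟩ := hL.ip4
  refine ⟨hbasic, ⟨N', hN', hadm, ?_⟩, V \ closure (rMap σ y₀ '' backSet σ π y₀ N₁ N₃ T),
    ⟨sdiff_subset.trans hV.1, fun z hz => ?_⟩, ?_⟩
  · exact (sdiff_subset_sdiff_right (subset_backSet hK.toBasic.subset T)).trans hsub
  · refine inter_mem (hV.2 z hz) (mem_nhdsWithin_of_mem_nhds
      (isClosed_closure.isOpen_compl.mem_nhds ?_))
    obtain ⟨u, hu, huN, rfl⟩ := hLK hz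
    exact notMem_closure_image_backSet hσπ hWN
      (fun s => ⟨_, hu 0 s, hW.2 _ (hu.mem_inv huN _)⟩) T
  · rintro p ⟨hpV, hp⟩
    exact ⟨(hVM hpV).1, fun hpB => hp (subset_closure ⟨p, hpB, rfl⟩)⟩

/-- Points of the repeller are not limits of points `r(p)` with `p ∈ N₂^{-T}(N₁)`. -/
theorem IsIndexTriple.notMem_closure_image_backSet (hσπ : σ.IsSkewProduct π)
    {K A R : Set (Y × X)} (hAR : IsARDecomp σ π y₀ K A R) {N₁ N₂ N₃ : Set (ℝ≥0 × X)}
    (h : IsIndexTriple σ π y₀ K A R N₁ N₂ N₃) (T : ℝ≥0) {z : Y × X} (hz : z ∈ R) :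
    z ∉ closure (rMap σ y₀ '' backSet σ π y₀ N₁ N₂ T) := by
  intro hcl
  obtain ⟨W, hW, hWN⟩ := h.pairK.ip5
  obtain ⟨NA, hNA, hadm, hsub⟩ := h.pairA.ip4
  obtain ⟨NR, hNR⟩ := hAR.R_isolated
  obtain ⟨u, hu, huN, rfl⟩ := hNR.2.2.2 ▸ hz
  have huR : ∀ t, u t ∈ R := fun t => hNR.2.2.2 ▸ hu.mem_inv huN t
  have hWu : ∀ t, W ∈ 𝓝[extSpace σ y₀] u t := fun t => hW.2 _ (hAR.R_subset (huR t))
  obtain ⟨x, hx, hxz⟩ := mem_closure_iff_seq_limit.1 hcl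
  choose p hp hpx using hx
  choose s hsT q hq hpq using fun n => (hp n).2
  obtain ⟨s₀, -, hs⟩ := exists_tendsto_of_le_nnreal (hyperfilter ℕ) (.of_forall hsT)
  have hqs : Tendsto (fun n => rMap σ y₀ (q n)) (hyperfilter ℕ) (𝓝 (u s₀)) :=
    π.tendsto_flow hs (hxz.mono_left Nat.hyperfilter_le_atTop) (by simpa using hu 0 s₀)
      (.of_forall fun n => hpx n ▸ flow_rMap_of_chi hσπ (hpq n))
  have hforward : ∀ t : ℝ≥0, u (s₀ + t) ∈ NA := by
    intro t
    have hstay : ∀ᶠ n in (hyperfilter ℕ : Filter ℕ), chiMem σ π y₀ t (q n) N₂ := by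
      by_contra hcon
      rw [← Ultrafilter.eventually_not] at hcon
      have hhit : ∀ n, ∃ τ, ∃ q', ¬ chiMem σ π y₀ t (q n) N₂ →
          τ ≤ t ∧ q' ∈ N₃ ∧ chi σ π y₀ τ (q n) = some q' := fun n => by
        by_cases hn : chiMem σ π y₀ t (q n) N₂
        · exact ⟨0, q n, fun hn' => absurd hn hn'⟩
        · obtain ⟨τ, hτ, q', hq', hqq'⟩ := h.pairA.toBasic.ip2 _ (hq n) t hn
          exact ⟨τ, q', fun _ => ⟨hτ, hq', hqq'⟩⟩
      choose τ q' hτ using hhit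
      obtain ⟨τ₀, -, hlim⟩ := exists_tendsto_of_le_nnreal (hyperfilter ℕ)
        (hcon.mono fun n hn => (hτ n hn).1)
      have hr := π.tendsto_flow hlim hqs (hu s₀ τ₀)
        (hcon.mono fun n hn => flow_rMap_of_chi hσπ (hτ n hn).2.2)
      obtain ⟨n, hn, hnN⟩ := ((eventually_rMap_mem hr (hWu _)).and hcon).exists
      exact (hWN hn).2 (hτ n hnN).2.1
    have hq' : ∀ n, ∃ q', chiMem σ π y₀ t (q n) N₂ →
        q' ∈ N₂ ∧ chi σ π y₀ t (q n) = some q' := fun n => by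
      by_cases hn : chiMem σ π y₀ t (q n) N₂
      · obtain ⟨q', hq'⟩ := hn
        exact ⟨q', fun _ => hq'⟩
      · exact ⟨q n, fun hn' => absurd hn' hn⟩
    choose q' hq' using hq'
    have hr := π.tendsto_flow tendsto_const_nhds hqs (hu s₀ t)
      (hstay.mono fun n hn => flow_rMap_of_chi hσπ (hq' n hn).2)
    refine hNA.2.1.mem_of_tendsto hr ?_
    filter_upwards [eventually_rMap_mem hr (hWu _), hstay] with n hn hnN
    exact hsub ⟨(hq' n hnN).1, (hWN hn).2⟩
  obtain ⟨w, v, hv, hvN, -⟩ := π.inv_nonempty_of_forward (hNA.2.1.inter hNR.2.1)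
    (hadm.mono inter_subset_left) (u := fun t => u (s₀ + t))
    (fun t s => by simpa [add_assoc] using hu (s₀ + t) s)
    (fun t ht => ⟨hforward ⟨t, ht⟩, huN _⟩)
  have hvA : v 0 ∈ A := hNA.2.2.2 ▸ hv.mem_inv (fun t => (hvN t).1) 0
  have hvR : v 0 ∈ R := hNR.2.2.2 ▸ hv.mem_inv (fun t => (hvN t).2) 0
  exact disjoint_left.1 hAR.disjoint hvA hvR

/-- A closed strongly admissible set disjoint from the repeller which contains the whole range of
a solution in `K` only does so for solutions in the attractor. -/
theorem IsARDecomp.mem_attractor {K A R : Set (Y × X)} (hAR : IsARDecomp σ π y₀ K A R)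
    {N : Set (Y × X)} (hN : IsClosed N) (hadm : π.StronglyAdmissible N) (hNR : Disjoint R N)
    {u : ℝ → Y × X} (hu : π.IsSolution u) (huK : ∀ t, u t ∈ K) (huN : ∀ t, u t ∈ N) (t : ℝ) :
    u t ∈ A := by
  rcases hAR.alternatives u hu huK with h | h | ⟨h, -⟩
  · exact h t
  · exact absurd (huN 0) (disjoint_left.1 hNR (h 0))
  · obtain ⟨w, hw, φ, hφ, l, hl⟩ := hadm.1 (fun n : ℕ => u (-(2 * n))) (fun n => n)
      fun n s _ => ⟨_, huN _, hu _ s⟩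
    have hwu : ∀ n : ℕ, w n = u (-n) := fun n => by
      have := hu (-(2 * n)) n
      rw [hw n, Option.some.injEq] at this
      rw [this]
      congr 1
      push_cast
      ring
    have hlN : l ∈ N := hN.mem_of_tendsto hl (.of_forall fun n => by
      simpa [hwu] using huN _)
    refine absurd hlN (disjoint_left.1 hNR (h (mem_iInter.2 fun t₀ => ?_)))
    refine mem_closure_of_tendsto hl ?_
    filter_upwards [(tendsto_natCast_atTop_atTop.comp hφ.tendsto_atTop).eventually_ge_atTop (-t₀)]
      with n hn
    exact ⟨-(φ n : ℝ), by simp only [Function.comp_apply] at hn; simp only [mem_Iic]; linarith,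
      (hwu _).symm⟩

theorem IsIndexTriple.pairA_backSet (hσπ : σ.IsSkewProduct π)
    {K A R : Set (Y × X)} (hAR : IsARDecomp σ π y₀ K A R) {N₁ N₂ N₃ : Set (ℝ≥0 × X)}
    (h : IsIndexTriple σ π y₀ K A R N₁ N₂ N₃) (T : ℝ≥0) :
    IsIndexPair σ π y₀ A (backSet σ π y₀ N₁ N₂ T) N₃ := by
  obtain ⟨V, hV, hVN⟩ := h.pairA.ip5
  obtain ⟨NK, hNK, hadm, hsub⟩ := h.pairK.ip4
  obtain ⟨NA, hNA, -, -⟩ := h.pairA.ip4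
  have hVM : rMap σ y₀ ⁻¹' V ⊆ backSet σ π y₀ N₁ N₂ T \ N₃ :=
    hVN.trans (sdiff_subset_sdiff_left (subset_backSet h.sub21 T))
  have hle : closure (rMap σ y₀ '' (backSet σ π y₀ N₁ N₂ T \ N₃)) ⊆ NK := by
    refine closure_minimal (image_subset_iff.2 ?_) hNK.2.1
    exact (sdiff_subset_sdiff_left fun _ hp => hp.1).trans hsub
  have hnhds : ∀ z ∈ A, closure (rMap σ y₀ '' (backSet σ π y₀ N₁ N₂ T \ N₃)) ∈
      𝓝[extSpace σ y₀] z := fun z hz => closure_image_rMap_mem_nhdsWithin (hV.2 z hz) hVM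
  have hdisj : Disjoint R (closure (rMap σ y₀ '' (backSet σ π y₀ N₁ N₂ T \ N₃))) :=
    disjoint_left.2 fun z hz hzN => h.notMem_closure_image_backSet hσπ hAR T hz
      (closure_mono (image_mono sdiff_subset) hzN)
  have hAinv : A = π.Inv (closure (rMap σ y₀ '' (backSet σ π y₀ N₁ N₂ T \ N₃))) := by
    refine Subset.antisymm (fun z hz => ?_) ?_
    · obtain ⟨u, hu, huN, rfl⟩ := hNA.2.2.2 ▸ hz
      refine hu.mem_inv (fun t => ?_) 0
      have huA : u t ∈ A := hNA.2.2.2 ▸ hu.mem_inv huN t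
      exact mem_of_mem_nhdsWithin (hNA.1 (huN t)) (hnhds _ huA)
    · rintro _ ⟨u, hu, huN, rfl⟩
      exact hAR.mem_attractor isClosed_closure (hadm.mono hle) hdisj hu
        (fun t => hNK.2.2.2 ▸ hu.mem_inv (fun t => hle (huN t)) t) huN 0
  refine ⟨h.pairK.toBasic.backSet_left hσπ h.pairA.toBasic h.sub21 T, ⟨_, ⟨hle.trans hNK.1,
    isClosed_closure, fun z hz => hnhds z (hAinv ▸ hz), hAinv⟩, hadm.mono hle, ?_⟩, V, hV, hVM⟩
  exact fun p hp => subset_closure ⟨p, hp, rfl⟩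

end Chi

theorem statement_14 (σ : GlobalSemiflow Y) (π : PartialSemiflow (Y × X)) (hσπ : σ.IsSkewProduct π) (y₀ : Y)
    (K A R : Set (Y × X))
    (hiso : ∃ N, IsIsolatingNbhd σ π y₀ K N ∧ π.StronglyAdmissible N)
    (hAR : IsARDecomp σ π y₀ K A R)
    (N₁ N₂ N₃ : Set (ℝ≥0 × X))
    (htriple : IsIndexTriple σ π y₀ K A R N₁ N₂ N₃) :
    ∀ T : ℝ≥0,
      IsIndexTriple σ π y₀ K A R N₁ (backSet σ π y₀ N₁ N₂ T) N₃ ∧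
      IsIndexTriple σ π y₀ K A R N₁ (backSet σ π y₀ N₁ N₂ T) (backSet σ π y₀ N₁ N₃ T) := by
  intro T
  have hpair := htriple.pairA_backSet hσπ hAR T
  have hK := htriple.pairK.toBasic.backSet_right hσπ T
  have hmono : backSet σ π y₀ N₁ N₃ T ⊆ backSet σ π y₀ N₁ N₂ T := backSet_mono htriple.sub32 T
  refine ⟨⟨hpair.toBasic.subset, fun _ hp => hp.1, htriple.pairK, hpair⟩,
    ⟨hmono, fun _ hp => hp.1, htriple.pairK.backSet_exit hσπ htriple.pairK subset_rfl T hK,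
      htriple.pairK.backSet_exit hσπ hpair hAR.A_subset T
        ⟨hmono, hpair.toBasic.closed₁, hK.closed₂, fun p hp t ht => ?_, fun p hp t ht => ?_⟩⟩⟩
  · obtain ⟨s, hs, h⟩ := hpair.toBasic.ip2 p hp t ht
    exact ⟨s, hs, h.mono (subset_backSet htriple.pairK.toBasic.subset T)⟩
  · obtain ⟨s, hs, h⟩ := hK.ip3 p hp t ht
    exact ⟨s, hs, fun hc => h (hc.mono fun _ hq => hq.1)⟩

end
end

section
/- Let K ⊂ H⁺(y₀)×X be an invariant set, let (N₁,N₂) be an index pair for (y₀,K), and define f : N₁ → [0,∞] by f(t,x) := sup{t₀ ≥ 0 : (t,x)χ_{y₀}s ∈ cl_{[0,∞)×X}(N₁∖N₂) for all s ∈ [0,t₀]} (with sup ∅ := 0). Then f is upper semicontinuous on N₁. -/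
open Filter Topology Set
open scoped NNReal ENNReal

noncomputable section

variable {X Y : Type*} [MetricSpace X] [MetricSpace Y]

variable {X Y : Type*} [MetricSpace X] [MetricSpace Y]

/-- The canonical semiflow is continuous: if `p χ s` is defined and lies in the open set `O`, then
`p' χ s` is defined and lies in `O` for all `p'` near `p`. -/
theorem chiMem_eventually (σ : GlobalSemiflow Y) (π : PartialSemiflow (Y × X)) (y₀ : Y)
    (s : ℝ≥0) (p : ℝ≥0 × X) {O : Set (ℝ≥0 × X)} (hO : IsOpen O) (h : chiMem σ π y₀ s p O) :
    ∀ᶠ p' in 𝓝 p, chiMem σ π y₀ s p' O := by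
  obtain ⟨q, hqO, hq⟩ := h
  obtain ⟨w, hw, rfl⟩ := Option.map_eq_some_iff.1 hq
  obtain ⟨U, V, hU, hV, hpU, hwV, hUV⟩ := isOpen_prod_iff.1 hO _ _ hqO
  have htrans : Continuous fun p' : ℝ≥0 × X => σ.trans p'.1 y₀ :=
    σ.continuous_trans.comp (continuous_fst.prodMk continuous_const)
  have hpt : Continuous fun p' : ℝ≥0 × X => (s, (σ.trans p'.1 y₀, p'.2)) :=
    continuous_const.prodMk (htrans.prodMk continuous_snd)
  have hadd : Continuous fun p' : ℝ≥0 × X => p'.1 + s := continuous_fst.add continuous_const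
  have h₁ := (hU.preimage hadd).mem_nhds hpU
  have h₂ := ((π.continuous_flow _ (hV.preimage continuous_snd)).preimage hpt).mem_nhds
    (show p ∈ _ from ⟨w, hwV, hw⟩)
  filter_upwards [h₁, h₂] with p' hp₁ hp₂
  obtain ⟨z, hzV, hz⟩ := hp₂
  exact ⟨(p'.1 + s, z.2), hUV ⟨hp₁, hzV⟩, by simp only [chi]; rw [hz]; rfl⟩

/-- The map `r` intertwines `χ` with `π`. -/
theorem rMap_of_chi_eq_some {σ : GlobalSemiflow Y} {π : PartialSemiflow (Y × X)}
    (hσπ : σ.IsSkewProduct π) {y₀ : Y} {s : ℝ≥0} {p q : ℝ≥0 × X}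
    (h : chi σ π y₀ s p = some q) : π.flow s (rMap σ y₀ p) = some (rMap σ y₀ q) := by
  obtain ⟨w, hw, rfl⟩ := Option.map_eq_some_iff.1 h
  have hw₁ := hσπ _ _ _ _ hw
  have : rMap σ y₀ (p.1 + s, w.2) = w := Prod.ext (by simp [rMap, hw₁, σ.trans_add]) rfl
  rw [this]
  exact hw

/-- A set on which the semiflow does not explode: if every defined point of the orbit of `z` up to
time `t` lies in `M`, then the orbit is defined at time `t`. -/
theorem PartialSemiflow.isSome_flow_of_forall_mem {Z : Type*} [TopologicalSpace Z]
    (π : PartialSemiflow Z) {M : Set Z}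
    (hM : ∀ (z : Z) (t : ℝ≥0), (∀ s < t, ∃ w ∈ M, π.flow s z = some w) → (π.flow t z).isSome)
    {z : Z} {t : ℝ≥0} (h : ∀ s ≤ t, ∀ w, π.flow s z = some w → w ∈ M) :
    (π.flow t z).isSome := by
  by_contra hne
  have hclosed : IsClosed {s : ℝ≥0 | ¬ (π.flow s z).isSome = true} :=
    (π.isOpen_dom.preimage (continuous_id.prodMk continuous_const)).isClosed_compl
  refine hclosed.csInf_mem ⟨t, hne⟩ (OrderBot.bddBelow _) (hM z _ fun s hs => ?_)
  obtain ⟨w, hw⟩ : ∃ w, π.flow s z = some w := by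
    by_contra hs'
    refine notMem_of_lt_csInf hs (OrderBot.bddBelow _) (fun hsome => hs' ?_)
    exact Option.isSome_iff_exists.1 hsome
  exact ⟨w, h s (hs.le.trans (csInf_le (OrderBot.bddBelow _) hne)) w hw, hw⟩

theorem statement_15 (σ : GlobalSemiflow Y) (π : PartialSemiflow (Y × X)) (hσπ : σ.IsSkewProduct π) (y₀ : Y)
    (K : Set (Y × X)) (hKsub : K ⊆ extSpace σ y₀) (hKinv : K = π.Inv K)
    (N₁ N₂ : Set (ℝ≥0 × X)) (hN : IsIndexPair σ π y₀ K N₁ N₂) :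
    UpperSemicontinuousOn (fTime σ π y₀ N₁ N₂) N₁ := by
  intro p _ c hc
  obtain ⟨b, hpb, hbc⟩ := ENNReal.lt_iff_exists_nnreal_btwn.1 hc
  obtain ⟨N, hNiso, hNadm, hNsub⟩ := hN.ip4
  have hr : Continuous (rMap (X := X) σ y₀) :=
    (σ.continuous_trans.comp (continuous_fst.prodMk continuous_const)).prodMk continuous_snd
  have hclN : closure (N₁ \ N₂) ⊆ rMap σ y₀ ⁻¹' N :=
    closure_minimal hNsub (hNiso.2.1.preimage hr)
  obtain ⟨s, hsb, hs⟩ : ∃ s ≤ b, chiMem σ π y₀ s p (closure (N₁ \ N₂))ᶜ := by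
    by_contra! hall
    have hin : ∀ s ≤ b, ∀ q, chi σ π y₀ s p = some q → q ∈ closure (N₁ \ N₂) :=
      fun s hs q hq => by_contra fun hqn => hall s hs ⟨q, hqn, hq⟩
    have hdef : ∀ s ≤ b, ∃ q, chi σ π y₀ s p = some q := by
      intro s hs
      obtain ⟨w, hw⟩ := Option.isSome_iff_exists.1 <|
        π.isSome_flow_of_forall_mem hNadm.2 (z := rMap σ y₀ p) (t := s) fun s' hs' w hw => by
          have hq : chi σ π y₀ s' p = some (p.1 + s', w.2) := Option.map_eq_some_iff.2 ⟨w, hw, rfl⟩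
          have hwr := (rMap_of_chi_eq_some hσπ hq).symm.trans hw
          rw [← Option.some.inj hwr]
          exact hclN (hin s' (hs'.trans hs) _ hq)
      exact ⟨_, Option.map_eq_some_iff.2 ⟨w, hw, rfl⟩⟩
    refine hpb.not_ge (le_iSup₂_of_le b (fun s hs => ?_) le_rfl)
    obtain ⟨q, hq⟩ := hdef s hs
    exact ⟨q, hin s hs q hq, hq⟩
  filter_upwards [nhdsWithin_le_nhds
    (chiMem_eventually σ π y₀ s p isClosed_closure.isOpen_compl hs)] with p' hp'
  obtain ⟨q, hq, hq'⟩ := hp'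
  refine lt_of_le_of_lt (iSup₂_le fun t ht => ?_) hbc
  by_contra! hbt
  obtain ⟨q₂, hq₂, hq₂'⟩ := ht s (hsb.trans (ENNReal.coe_lt_coe.1 hbt).le)
  exact hq (Option.some.inj (hq'.symm.trans hq₂') ▸ hq₂)

end
end
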